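/- Let ω = e^{2πi/3} ∈ ℂ (a primitive third root of unity) and define the 6×6 complex matrices A and B by rows as follows. A: row 1 = (1, 1−ω, 1−ω², ω−1, ω²−1, ω−1); row 2 = (ω²−1, ω², 0, 1−ω², 0, 0); row 3 = (ω²−1, ω²−1, ω², 1−ω², 1−ω², 0); row 4 = (0, ω−1, ω²−1, −ω, 1−ω², 1−ω); row 5 = (1−ω², 1−ω², 0, ω²−1, −1, 0); row 6 = (1−ω², 1−ω², 1−ω², ω²−1, ω²−1, −1). B: row 1 = (1, 1−ω, 1−ω², 1−ω, 1−ω², 1−ω); row 2 = (ω²−1, ω², 0, ω²−1, 0, 0); row 3 = (ω²−1, ω²−1, ω², ω²−1, ω²−1, 0); row 4 = (0, 1−ω, 1−ω², −ω, 1−ω², 1−ω); row 5 = (ω²−1, ω²−1, 0, ω²−1, −1, 0); row 6 = (ω²−1, ω²−1, ω²−1, ω²−1, ω²−1, −1). Then: (i) A and B are invertible and ABA = BAB, so they define a representation of B₃; (ii) this representation is irreducible, i.e., no subspace of ℂ⁶ other than 0 and ℂ⁶ is invariant under both A and B; and (iii) there exist no matrices S₁, S₂ ∈ M₆(ℂ)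 with S₁² = S₂² = I, S₁S₂S₁ = S₂S₁S₂, S₁S₂A = BS₁S₂ and ABS₁ = S₂AB; that is, this B₃ representation admits no extension to LB₃. -/

import Mathlib

lemma quad_sys (p q r t u : ℂ)
    (e0 : - 36*p*q + 30*p*p + 42*q*q + 12*p*r + 24*p*u + 12*q*t + 6*u*u = 0)
    (e1 : 36*p*q + 36*q*u + 12*p*r - 24*p*t + 6*q*q + 36*q*t - 12*t*u = 0)
    (e2 : 12*p*q - 12*p*t - 24*p*p - 36*p*u + 6*r*r - 12*q*q - 12*t*u - 18*u*u = 0)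
    (e3 : 60*p*q - 48*p*p - 60*p*u - 24*u*u + 6*r*r - 36*q*q + 24*q*u + 6*t*t = 0)
    (e4 : 8*p*t + 4*t*u + 12*p*q - 2*p*p + 4*p*u - 8*q*t + 2*u*u - 12*q*q = 0)
    (e5 : 16*p*p - 32*p*q + 20*q*q + 16*p*u - 12*q*u + 8*p*t + 4*r*t + 8*t*u + 6*u*u - 2*r*r = 0)
    (e6 : - 24*p*p + 12*p*q - 24*p*u - 12*p*r - 12*q*u - 6*u*u + 24*p*t - 36*q*t + 6*t*t + 12*t*u - 24*q*q = 0) :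
    p = 0 ∧ q = 0 ∧ r = 0 ∧ t = 0 ∧ u = 0 := by
  have cp : p^3 = 0 := by
    linear_combination ((-59/76)*p + (1169/684)*q + (-8605/16416)*r + (-223/304)*u + (7411/16416)*t)*e0 +
      ((167/152)*p + (-449/152)*q + (-15587/16416)*r + (8525/16416)*t + (2693/2736)*u)*e1 +
      ((4439/1824)*p + (-3641/1368)*q + (-1109/1824)*r + (6485/5472)*t + (24059/16416)*u)*e2 +
      ((-1177/912)*p + (1459/1368)*q + (815/2736)*r + (-1/19)*t + (-2381/4104)*u)*e3 +
      ((229/152)*p + (-41/912)*q + (-8213/5472)*r + (11441/5472)*t + (271/152)*u)*e4 +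
      ((1533/608)*p + (-1091/228)*q + (-1697/1824)*r + (2803/1824)*t + (85/32)*u)*e5 +
      ((105/152)*p + (-2711/1368)*q + (-201/152)*r + (1/19)*t + (3619/8208)*u)*e6
  have cq : q^3 = 0 := by
    linear_combination ((-1/114)*t + (13/114)*p + (-47/684)*q + (10/171)*r + (7/1026)*u)*e2 +
      ((-67/1026)*t + (-61/684)*q + (37/1026)*r + (17/171)*p + (31/342)*u)*e0 +
      ((89/1026)*r + (71/684)*q + (4/19)*p + (79/1026)*t + (43/342)*u)*e1 +
      ((65/342)*q + (-139/684)*p + (-5/228)*r + (-73/684)*t + (-185/2052)*u)*e3 +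
      ((16/57)*p + (-89/228)*q + (25/171)*r + (-11/342)*t + (4/57)*u)*e4 +
      ((-13/76)*p + (83/228)*q + (25/228)*r + (-29/228)*t + (-1/4)*u)*e5 +
      ((191/684)*p + (13/171)*q + (73/684)*r + (73/684)*t + (419/2052)*u)*e6
  have cr : r^3 = 0 := by
    linear_combination ((-1967/608)*p + (479/76)*q + (1865/608)*r + (-1563/608)*t + (-311/32)*u)*e5 +
      ((1631/1368)*p + (-607/171)*q + (4901/5472)*r + (4939/2736)*u + (-14051/5472)*t)*e0 +
      ((-529/76)*p + (5273/1368)*q + (3547/5472)*r + (-21277/5472)*t + (-27685/2736)*u)*e1 +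
      ((-21317/1824)*p + (3293/456)*q + (1333/5472)*r + (-31511/5472)*t + (-48595/5472)*u)*e2 +
      ((24781/2736)*p + (-2335/456)*q + (2587/2736)*r + (977/342)*t + (7717/1368)*u)*e3 +
      ((-814/57)*p + (5467/912)*q + (7213/1824)*r + (-21025/1824)*t + (-2923/228)*u)*e4 +
      ((-8077/1368)*p + (491/456)*q + (1051/1368)*r + (-977/342)*t + (-22187/2736)*u)*e6
  have ct : t^3 = 0 := by
    linear_combination ((91/1368)*q + (151/456)*p + (1/152)*r + (17/57)*t + (3433/8208)*u)*e6 +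
      ((-13/684)*q + (689/16416)*r + (1969/16416)*t + (65/456)*p + (47/912)*u)*e0 +
      ((7/38)*p + (43/456)*q + (-977/16416)*r + (5039/16416)*t + (1061/2736)*u)*e1 +
      ((581/1824)*p + (-239/1368)*q + (-103/1824)*r + (1535/5472)*t + (3689/16416)*u)*e2 +
      ((-311/912)*p + (313/1368)*q + (-43/2736)*r + (-5/38)*t + (-623/4104)*u)*e3 +
      ((63/76)*p + (-359/912)*q + (-839/5472)*r + (2411/5472)*t + (49/76)*u)*e4 +
      ((-129/608)*p + (37/228)*q + (-395/1824)*r + (25/1824)*t + (7/32)*u)*e5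
  have cu : u^3 = 0 := by
    linear_combination ((8983/8208)*u + (563/456)*p + (2005/1368)*q + (629/456)*r + (8/19)*t)*e6 +
      ((1811/912)*u + (-265/171)*q + (15767/16416)*r + (-2633/16416)*t + (427/228)*p)*e0 +
      ((-8503/16416)*t + (9577/16416)*r + (341/152)*q + (-115/456)*p + (-1579/2736)*u)*e1 +
      ((1519/1368)*q + (-1127/608)*p + (191/1824)*r + (-3391/5472)*t + (-28897/16416)*u)*e2 +
      ((-125/912)*p + (1735/1368)*q + (155/2736)*r + (-8/19)*t + (1111/4104)*u)*e3 +
      ((-163/152)*p + (-233/912)*q + (7807/5472)*r + (-13219/5472)*t + (-207/152)*u)*e4 +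
      ((-3031/608)*p + (1627/228)*q + (883/1824)*r + (-3929/1824)*t + (-143/32)*u)*e5
  exact ⟨pow_eq_zero_iff (by norm_num) |>.1 cp, pow_eq_zero_iff (by norm_num) |>.1 cq, pow_eq_zero_iff (by norm_num) |>.1 cr, pow_eq_zero_iff (by norm_num) |>.1 ct, pow_eq_zero_iff (by norm_num) |>.1 cu⟩

def Gm : Matrix (Fin 6) (Fin 6) ℂ := !![0, 3, 0, 3, 6, 3; 0, 0, 0, -6, 0, 0; 0, 0, 0, -6, -6, 0; 0, -1, -2, 1, 0, 3; 2, 2, 0, 0, -2, 0; 2, 2, 2, 0, 0, -2]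
def Hm : Matrix (Fin 6) (Fin 6) ℂ := !![0, -1, -2, 3, 0, 3; 2, 2, 0, 0, 0, 0; 2, 2, 2, 0, 0, 0; 0, -1, 0, 1, -2, -1; 0, 0, 0, 2, 2, 0; 0, 0, 0, 2, 2, 2]
def Um : Matrix (Fin 6) (Fin 6) ℂ := Matrix.diagonal ![1,1,1,-1,-1,-1]

set_option maxHeartbeats 4000000 in
lemma param (Y : Matrix (Fin 6) (Fin 6) ℂ) (hG : Y * Gm = Gm * Y) (hH : Y * Hm = Hm * Y) :
    ∃ p q r t u s : ℂ, Y = !![4*p + 2*r + 3*u + 1*s, 2*p - 3*q + 1*r, 1*p, - 3*q - 3*t, 6*p - 6*q + 3*u, - 3*q;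
      - 1*p, 3*p + 1*r + 3*u + 1*s, 1*r, - 3*p + 6*q, - 3*p - 3*t - 3*u, 3*p + 3*u;
      - 1*p - 1*r, 2*p + 1*r + 3*u, 1*s, - 9*p + 6*q - 3*r - 6*u, 6*q + 3*r + 3*u, - 6*p - 3*r - 3*t - 6*u;
      1*t, 1*q + 1*t, - 2*p + 2*q - 1*u, 4*p - 1*q + 2*r + 3*u + 1*s, 1*r - 1*t - 1*u, 3*p - 3*q + 1*u;
      2*p - 2*q + 1*u, 1*p - 2*q, 1*p + 1*t + 1*u, 1*u, 1*p + 2*q + 1*r + 1*t + 2*u + 1*s, 1*r - 1*t;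
      1*p - 2*q - 1*t, 3*p - 2*q + 1*r + 2*u, - 2*q - 1*r - 1*u, - 3*p - 2*r - 1*t - 2*u, 3*p + 1*r + 2*t + 4*u, - 2*p + 2*q - 1*t - 1*u + 1*s] := by
  have g10 := congrFun (congrFun hG 1) 0
  have g12 := congrFun (congrFun hG 1) 2
  have g13 := congrFun (congrFun hG 1) 3
  have g14 := congrFun (congrFun hG 1) 4
  have g15 := congrFun (congrFun hG 1) 5
  have g20 := congrFun (congrFun hG 2) 0
  have g22 := congrFun (congrFun hG 2) 2
  have g24 := congrFun (congrFun hG 2) 4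
  have g34 := congrFun (congrFun hG 3) 4
  have g40 := congrFun (congrFun hG 4) 0
  have g44 := congrFun (congrFun hG 4) 4
  have g54 := congrFun (congrFun hG 5) 4
  have h10 := congrFun (congrFun hH 1) 0
  have h11 := congrFun (congrFun hH 1) 1
  have h12 := congrFun (congrFun hH 1) 2
  have h13 := congrFun (congrFun hH 1) 3
  have h14 := congrFun (congrFun hH 1) 4
  have h15 := congrFun (congrFun hH 1) 5
  have h20 := congrFun (congrFun hH 2) 0
  have h22 := congrFun (congrFun hH 2) 2
  have h25 := congrFun (congrFun hH 2) 5
  have h40 := congrFun (congrFun hH 4) 0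
  have h41 := congrFun (congrFun hH 4) 1
  have h42 := congrFun (congrFun hH 4) 2
  have h44 := congrFun (congrFun hH 4) 4
  have h45 := congrFun (congrFun hH 4) 5
  have h50 := congrFun (congrFun hH 5) 0
  have h52 := congrFun (congrFun hH 5) 2
  have h54 := congrFun (congrFun hH 5) 4
  have h55 := congrFun (congrFun hH 5) 5
  simp [Matrix.mul_apply, Fin.sum_univ_six, Gm, Hm] at g10 g12 g13 g14 g15 g20 g22 g24 g34 g40 g44 g54 h10 h11 h12 h13 h14 h15 h20 h22 h25 h40 h41 h42 h44 h45 h50 h52 h54 h55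
  refine ⟨Y 0 2, (-1/3) * Y 0 5, Y 1 2, Y 3 0, Y 4 3, Y 2 2, ?_⟩
  ext i j
  fin_cases i <;> fin_cases j <;> simp
  · linear_combination (1)*h12 + (1)*h22 + (2/3)*g15 + (1)*g12 + (5/2)*h42 + (-1/6)*g10 + (1/2)*h44 + (2)*h45 + (-1/6)*g44 + (1/6)*h14 + (1/6)*g20 + (1/3)*h25 + (-1/3)*h15 + (-1/6)*g22 + (-1/2)*g40 + (1/6)*g24
  · linear_combination (1)*h12 + (1/2)*h15 + (-1/2)*h11
  · linear_combination (1/2)*h15 + (1/2)*g10 + (-1/2)*h13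
  · linear_combination (3)*h12 + (1)*g15 + (3/2)*g12 + (9/2)*h42 + (3)*h45 + (-1/2)*h14 + (1)*h15
  · ring
  · linear_combination (-1/2)*h12
  · linear_combination (1/2)*h12 + (1)*h22 + (2/3)*g15 + (1)*g12 + (5/2)*h42 + (-1/6)*g10 + (1/2)*h44 + (2)*h45 + (-1/6)*g44 + (1/6)*h14 + (1/6)*g20 + (1/3)*h25 + (-1/3)*h15 + (-1/6)*g22 + (-1/2)*g40 + (1/2)*h10 + (1/6)*g24
  · linear_combination (-3/2)*h12 + (-1)*h15
  · linear_combination (-3/2)*h12 + (-1)*g15 + (-3/2)*g12 + (-9/2)*h42 + (1/2)*g10 + (-3)*h45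
  · linear_combination (3/2)*h12 + (1)*g15 + (3/2)*g12 + (9/2)*h42 + (3)*h45
  · linear_combination (-1/2)*h22
  · linear_combination (1/2)*h12 + (1/2)*h22 + (2/3)*g15 + (1)*g12 + (5/2)*h42 + (-1/6)*g10 + (1/2)*h44 + (2)*h45 + (-1/6)*g44 + (1/6)*h14 + (1/6)*g20 + (1/3)*h25 + (-1/3)*h15 + (-1/6)*g22 + (1/2)*h20 + (-1/2)*g40 + (1/6)*g24
  · linear_combination (-3)*h12 + (-3/2)*h22 + (-2)*g15 + (-3)*g12 + (-9)*h42 + (-6)*h45 + (-1)*h25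
  · linear_combination (-2)*h15 + (2)*g12 + (9/2)*h42 + (3/2)*h22 + (-3/2)*h12 + (-1/2)*g10 + (1)*g15 + (3)*h45 + (-1/2)*g44 + (1/2)*h14 + (1/2)*g20 + (1)*h25 + (-1/2)*g22
  · linear_combination (-3/2)*h12 + (-3/2)*h22 + (-2)*g15 + (-3)*g12 + (-15/2)*h42 + (1/2)*g10 + (-6)*h45 + (1/2)*g44 + (-1/2)*h14 + (-1)*h25 + (1)*h15 + (1/2)*g22
  · linear_combination (-1/6)*h15 + (1/6)*g12 + (1/2)*h42 + (-1/6)*g10 + (1/6)*g15 + (1/2)*h45 + (-1/6)*g44 + (1/6)*h14 + (-1/2)*h41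
  · linear_combination (-1)*h12 + (-1/3)*g15 + (-1/3)*g12 + (-3/2)*h42 + (-1)*h45 + (-1/3)*h15
  · linear_combination (1)*h12 + (1)*h22 + (2/3)*g15 + (1)*g12 + (5/2)*h42 + (-1/6)*g10 + (1/2)*h44 + (2)*h45 + (-1/6)*g44 + (1/6)*h14 + (1/6)*g20 + (1/3)*h25 + (-1/6)*h15 + (-1/6)*g22 + (1/6)*g24 + (-1/2)*g40 + (1/2)*h10 + (1/6)*g13
  · linear_combination (-3/2)*h42 + (-1)*h45 + (1/6)*g10 + (1/6)*g14 + (-1/2)*g12 + (-1/3)*g15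
  · linear_combination (3/2)*h12 + (1/2)*g15 + (1/2)*g12 + (3/2)*h42 + (1)*h45 + (1/2)*h15
  · linear_combination (1)*h12 + (1/3)*g15 + (1/3)*g12 + (1)*h42 + (1)*h45 + (1/3)*h15
  · linear_combination (1/2)*h12 + (1/6)*g10 + (1/6)*g44 + (-1/6)*h14 + (1/2)*h40 + (1/3)*h15
  · linear_combination (1/2)*h12 + (1/3)*g15 + (1/3)*g12 + (1)*h42 + (-1/6)*g10 + (1)*h45 + (-1/6)*g44 + (1/6)*h14
  · linear_combination (-1/2)*h12 + (1)*h22 + (2/3)*g15 + (7/6)*g12 + (3)*h42 + (-1/6)*g14 + (-1/3)*g10 + (2)*h45 + (-1/6)*g44 + (1/6)*h14 + (1/6)*g20 + (1/3)*h25 + (-2/3)*h15 + (-1/6)*g22 + (1/6)*g24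
  · linear_combination (-1/3)*g15 + (-1/2)*g12 + (-3/2)*h42 + (1/6)*g14 + (1/6)*g10 + (1/2)*h44 + (-1)*h45
  · linear_combination (1/2)*h12 + (1/2)*h42 + (-1/2)*h52 + (1/6)*g10 + (1/6)*g44 + (-1/6)*h14 + (1/3)*h15
  · linear_combination (1)*h12 + (1/2)*h22 + (2/3)*g15 + (1)*g12 + (5/2)*h42 + (2)*h45 + (-1/6)*g44 + (1/6)*g54 + (1/6)*g20 + (1/3)*h25 + (-1/6)*g22 + (1/2)*h50
  · linear_combination (2/3)*h15 + (-2/3)*g12 + (-1)*h42 + (-1/2)*h22 + (1/2)*h12 + (-1/2)*h52 + (1/6)*g10 + (-1/3)*g15 + (-1)*h45 + (1/3)*g44 + (-1/6)*h14 + (-1/6)*g54 + (-1/6)*g20 + (-1/3)*h25 + (1/6)*g22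
  · linear_combination (-3/2)*h12 + (-1/3)*g15 + (3/2)*h42 + (-3/2)*h52 + (-1/3)*g14 + (1/6)*g10 + (-1)*h44 + (1/2)*g44 + (-1/2)*h14 + (-1)*h55
  · linear_combination (1/2)*h12 + (1)*h22 + (4/3)*g15 + (2)*g12 + (6)*h42 + (-1/6)*g14 + (-1/3)*g10 + (4)*h45 + (-1/3)*g44 + (1/3)*h14 + (1/3)*g20 + (2/3)*h25 + (-2/3)*h15 + (-1/3)*g22 + (-1/3)*g34
  · linear_combination (-2)*h12 + (1)*h22 + (2/3)*g12 + (3)*h42 + (-3/2)*h52 + (-1/3)*g14 + (-1)*h44 + (1)*h45 + (1/3)*g44 + (-1/3)*h14 + (1/2)*h54 + (-1)*h55 + (1/6)*g20 + (1/3)*h25 + (-2/3)*h15 + (-1/6)*g22 + (1/6)*g24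

set_option maxHeartbeats 4000000 in
lemma key (Y : Matrix (Fin 6) (Fin 6) ℂ) (hG : Y * Gm = Gm * Y) (hH : Y * Hm = Hm * Y)
    (hU : Y * Um * Y * Um = Um * Y * Um * Y) : ∃ c : ℂ, Y = c • (1 : Matrix (Fin 6) (Fin 6) ℂ) := by
  obtain ⟨p, q, r, t, u, s, hY⟩ := param Y hG hH
  clear hG hH
  have e0 := congrFun (congrFun hU 0) 3
  have e1 := congrFun (congrFun hU 0) 5
  have e2 := congrFun (congrFun hU 1) 3
  have e3 := congrFun (congrFun hU 1) 5
  have e4 := congrFun (congrFun hU 3) 0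
  have e5 := congrFun (congrFun hU 4) 1
  have e6 := congrFun (congrFun hU 0) 4
  simp [Matrix.mul_apply, Fin.sum_univ_six, Um, Matrix.diagonal_apply] at e0 e1 e2 e3 e4 e5 e6
  clear hU
  subst hY
  simp at e0 e1 e2 e3 e4 e5 e6
  obtain ⟨rfl, rfl, rfl, rfl, rfl⟩ := quad_sys p q r t u
    (by linear_combination e0)
    (by linear_combination e1)
    (by linear_combination e2)
    (by linear_combination e3)
    (by linear_combination e4)
    (by linear_combination e5)
    (by linear_combination e6)
  refine ⟨s, ?_⟩
  ext i j
  fin_cases i <;> fin_cases j <;> simp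

def Am (w : ℂ) : Matrix (Fin 6) (Fin 6) ℂ :=
  !![1, 1 - w, 1 - w^2, w - 1, w^2 - 1, w - 1;
     w^2 - 1, w^2, 0, 1 - w^2, 0, 0;
     w^2 - 1, w^2 - 1, w^2, 1 - w^2, 1 - w^2, 0;
     0, w - 1, w^2 - 1, -w, 1 - w^2, 1 - w;
     1 - w^2, 1 - w^2, 0, w^2 - 1, -1, 0;
     1 - w^2, 1 - w^2, 1 - w^2, w^2 - 1, w^2 - 1, -1]

def Bm (w : ℂ) : Matrix (Fin 6) (Fin 6) ℂ :=
  !![1, 1 - w, 1 - w^2, 1 - w, 1 - w^2, 1 - w;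
     w^2 - 1, w^2, 0, w^2 - 1, 0, 0;
     w^2 - 1, w^2 - 1, w^2, w^2 - 1, w^2 - 1, 0;
     0, 1 - w, 1 - w^2, -w, 1 - w^2, 1 - w;
     w^2 - 1, w^2 - 1, 0, w^2 - 1, -1, 0;
     w^2 - 1, w^2 - 1, w^2 - 1, w^2 - 1, w^2 - 1, -1]

/-- The product `A * B`. -/
def Dm (w : ℂ) : Matrix (Fin 6) (Fin 6) ℂ :=
  !![1, 2 + w, 1 - w, 2 + w, 1 - w, 2 + w;
     w - 1, w, 0, w - 1, 0, 0;
     w - 1, w - 1, w, w - 1, w - 1, 0;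
     0, -2 - w, w - 1, -1 - w, w - 1, -2 - w;
     1 - w, 1 - w, 0, 1 - w, 1, 0;
     1 - w, 1 - w, 1 - w, 1 - w, 1 - w, 1]

/-- The inverse of `A`. -/
def Aim (w : ℂ) : Matrix (Fin 6) (Fin 6) ℂ :=
  !![1, 2 + w, 1 - w, 2 + w, 1 - w, 2 + w;
     w - 1, w, 0, w - 1, 0, 0;
     w - 1, w - 1, w, w - 1, w - 1, 0;
     0, 2 + w, 1 - w, 1 + w, 1 - w, 2 + w;
     w - 1, w - 1, 0, w - 1, -1, 0;
     w - 1, w - 1, w - 1, w - 1, w - 1, -1]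

def Vm (w : ℂ) : Matrix (Fin 6) (Fin 6) ℂ :=
  Matrix.diagonal ![1, 1, 1, 1 + 2 * w, 1 + 2 * w, 1 + 2 * w]

noncomputable def Vim (w : ℂ) : Matrix (Fin 6) (Fin 6) ℂ :=
  Matrix.diagonal ![1, 1, 1, -(1 + 2 * w) / 3, -(1 + 2 * w) / 3, -(1 + 2 * w) / 3]

set_option maxHeartbeats 4000000 in
lemma AB_eq (w : ℂ) (hw : w ^ 2 = -1 - w) : Am w * Bm w = Dm w := by
  ext i j
  fin_cases i <;> fin_cases j <;>
    simp [Matrix.mul_apply, Fin.sum_univ_six, Am, Bm, Dm, hw] <;> grind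

set_option maxHeartbeats 4000000 in
lemma DA_eq (w : ℂ) (hw : w ^ 2 = -1 - w) : Dm w * Am w = Um := by
  ext i j
  fin_cases i <;> fin_cases j <;>
    simp [Matrix.mul_apply, Fin.sum_univ_six, Am, Dm, Um, hw] <;> grind

set_option maxHeartbeats 4000000 in
lemma BD_eq (w : ℂ) (hw : w ^ 2 = -1 - w) : Bm w * Dm w = Um := by
  ext i j
  fin_cases i <;> fin_cases j <;>
    simp [Matrix.mul_apply, Fin.sum_univ_six, Bm, Dm, Um, hw] <;> grind

set_option maxHeartbeats 4000000 in
lemma A_Ai (w : ℂ) (hw : w ^ 2 = -1 - w) : Am w * Aim w = 1 := by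
  ext i j
  fin_cases i <;> fin_cases j <;>
    simp [Matrix.mul_apply, Fin.sum_univ_six, Am, Aim, hw] <;> grind

lemma U_U : Um * Um = 1 := by
  ext i j
  fin_cases i <;> fin_cases j <;> simp [Um]

lemma Vi_V (w : ℂ) (hw : w ^ 2 = -1 - w) : Vim w * Vm w = 1 := by
  ext i j
  fin_cases i <;> fin_cases j <;> simp [Vm, Vim] <;> grind

lemma V_U (w : ℂ) : Vm w * Um = Um * Vm w := by
  ext i j
  fin_cases i <;> fin_cases j <;> simp [Vm, Um]

set_option maxHeartbeats 4000000 in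
lemma V_G (w : ℂ) (hw : w ^ 2 = -1 - w) :
    Vm w * Gm = ((1 + w) • Am w + (-w) • Aim w + (-1 : ℂ) • 1) * Vm w := by
  ext i j
  fin_cases i <;> fin_cases j <;> simp [Vm, Gm, Am, Aim, hw] <;> grind

set_option maxHeartbeats 4000000 in
lemma V_H (w : ℂ) (hw : w ^ 2 = -1 - w) :
    Vm w * Hm = (((w - 1) / 3) • Am w + ((-2 - w) / 3) • Aim w + (1 : ℂ) • 1) * Vm w := by
  ext i j
  fin_cases i <;> fin_cases j <;> simp [Vm, Hm, Am, Aim, hw] <;> grind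

lemma group_aux {M : Type*} [Monoid M] (A B D U Ai S T : M)
    (hAB : A * B = D) (hDA : D * A = U) (hBD : B * D = U) (hU : U * U = 1) (hAi : A * Ai = 1)
    (hAi' : Ai * A = 1)
    (hS : S * S = 1) (hT : T * T = 1) (hST : S * T * S = T * S * T)
    (h1 : S * T * A = B * (S * T)) (h2 : D * S = T * D) :
    D * D * D = 1 ∧ (S * T) * (S * T) * (S * T) = 1 ∧ S * T * D = S * D * S ∧
    (D * D * (S * T)) * A = A * (D * D * (S * T)) ∧
    (D * D * (S * T)) * U * (D * D * (S * T)) * U =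
      U * (D * D * (S * T)) * U * (D * D * (S * T)) := by
  have hD3 : D * D * D = 1 := by
    calc D * D * D = (D * A) * (B * D) := by rw [← hAB]; simp only [mul_assoc]
      _ = 1 := by rw [hDA, hBD, hU]
  have hD3' : D * (D * D) = 1 := by rw [← mul_assoc, hD3]
  have hTD : S * T * D = S * D * S := by rw [mul_assoc, ← h2, mul_assoc]
  have hT3 : (S * T) * (S * T) * (S * T) = 1 := by
    calc (S * T) * (S * T) * (S * T) = (S * T * S) * (T * S * T) := by simp only [mul_assoc]
      _ = S * T * (S * S) * T * S := by rw [← hST]; simp only [mul_assoc]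
      _ = S * (T * T) * S := by rw [hS]; simp only [mul_assoc, mul_one, one_mul]
      _ = 1 := by rw [hT, mul_one, hS]
  have hDDB : D * D * B = A * (D * D) := by
    calc D * D * B = D * D * B * (D * (D * D)) := by rw [hD3', mul_one]
      _ = D * D * (B * D) * (D * D) := by simp only [mul_assoc]
      _ = D * D * D * A * (D * D) := by rw [hBD, ← hDA]; simp only [mul_assoc]
      _ = A * (D * D) := by rw [hD3, one_mul]
  have hCA : (D * D * (S * T)) * A = A * (D * D * (S * T)) := by
    rw [mul_assoc, h1, ← mul_assoc, hDDB, mul_assoc]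
  refine ⟨hD3, hT3, hTD, hCA, ?_⟩
  have hAU : D * D = A * U := by
    calc D * D = D * D * (U * U) := by rw [hU, mul_one]
      _ = D * D * D * A * U := by nth_rewrite 1 [← hDA]; simp only [mul_assoc]
      _ = A * U := by rw [hD3, one_mul]
  have hUA : D = U * Ai := by rw [← hDA, mul_assoc, hAi, mul_one]
  generalize hP : S * T = P at *
  have hPD3 : (P * D) * (P * D) * (P * D) = 1 := by
    calc (P * D) * (P * D) * (P * D) = S * D * (S * S) * D * (S * S) * D * S := by
          rw [hTD]; simp only [mul_assoc]
      _ = S * (D * D * D) * S := by rw [hS]; simp only [mul_assoc, mul_one, one_mul]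
      _ = 1 := by rw [hD3, mul_one, hS]
  have hinv : (P * D) * (D * D * (P * P)) = 1 := by
    calc (P * D) * (D * D * (P * P)) = P * (D * D * D) * (P * P) := by simp only [mul_assoc]
      _ = 1 := by rw [hD3, mul_one, ← mul_assoc, hT3]
  have hPP : (P * D) * (P * D) = D * D * (P * P) := left_inv_eq_right_inv hPD3 hinv
  set C := D * D * P with hC
  have hcomm : C * (D * D * C * D) = (D * D * C * D) * C := by
    calc C * (D * D * C * D) = D * D * P * (D * D * D) * D * P * D := by
          rw [hC]; simp only [mul_assoc]
      _ = D * D * ((P * D) * (P * D)) := by rw [hD3]; simp only [mul_assoc, mul_one, one_mul]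
      _ = (D * D * D) * D * P * (D * D * D) * P := by
          rw [hPP, hD3]; simp only [mul_assoc, mul_one, one_mul]
          rw [← mul_assoc D D (D * _), ← mul_assoc (D * D) D, hD3, one_mul]
      _ = (D * D * C * D) * C := by rw [hC]; simp only [mul_assoc]
  have hCAi : C * Ai = Ai * C := by
    calc C * Ai = Ai * A * C * Ai := by rw [hAi', one_mul]
      _ = Ai * (C * A) * Ai := by rw [hCA]; simp only [mul_assoc]
      _ = Ai * C * (A * Ai) := by simp only [mul_assoc]
      _ = Ai * C := by rw [hAi, mul_one]
  have hK : D * D * C * D = A * (U * C * U) * Ai := by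
    calc D * D * C * D = A * U * C * D := by rw [hAU]
      _ = A * U * C * (U * Ai) := by rw [← hUA]
      _ = A * (U * C * U) * Ai := by simp only [mul_assoc]
  rw [hK] at hcomm
  calc C * U * C * U = (Ai * A) * C * (U * C * U) * (Ai * A) := by
        rw [hAi']; simp only [mul_assoc, mul_one, one_mul]
    _ = Ai * (C * (A * (U * C * U) * Ai)) * A := by
        rw [mul_assoc Ai A C, ← hCA]; simp only [mul_assoc]
    _ = Ai * (A * (U * C * U) * Ai * C) * A := by rw [hcomm]
    _ = (Ai * A) * (U * C * U) * (C * Ai) * A := by rw [hCAi]; simp only [mul_assoc]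
    _ = U * C * U * C := by
        rw [hAi', mul_assoc _ (C * Ai) A, mul_assoc C Ai A, hAi']
        simp only [mul_assoc, mul_one, one_mul]

lemma conj_comm (w : ℂ) (hw : w ^ 2 = -1 - w) (X L G : Matrix (Fin 6) (Fin 6) ℂ)
    (hL : X * L = L * X) (hV : Vm w * G = L * Vm w) :
    (Vim w * X * Vm w) * G = G * (Vim w * X * Vm w) := by
  have h1 : Vim w * Vm w = 1 := Vi_V w hw
  have h2 : Vm w * Vim w = 1 := mul_eq_one_comm.1 h1
  have h3 : G * Vim w = Vim w * L := by
    calc G * Vim w = (Vim w * Vm w) * G * Vim w := by rw [h1, one_mul]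
      _ = Vim w * (Vm w * G) * Vim w := by simp only [mul_assoc]
      _ = Vim w * L * (Vm w * Vim w) := by rw [hV]; simp only [mul_assoc]
      _ = Vim w * L := by rw [h2, mul_one]
  calc (Vim w * X * Vm w) * G = Vim w * (X * L) * Vm w := by
        rw [mul_assoc, hV]; simp only [mul_assoc]
    _ = G * (Vim w * X * Vm w) := by
        rw [hL, ← mul_assoc, ← h3]; simp only [mul_assoc]

lemma scalar_of_comm (w : ℂ) (hw : w ^ 2 = -1 - w) (X : Matrix (Fin 6) (Fin 6) ℂ)
    (hA : X * Am w = Am w * X) (hU : X * Um * X * Um = Um * X * Um * X) :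
    ∃ c : ℂ, X = c • (1 : Matrix (Fin 6) (Fin 6) ℂ) := by
  have hA1 := A_Ai w hw
  have hA2 : Aim w * Am w = 1 := mul_eq_one_comm.1 hA1
  have hAi : X * Aim w = Aim w * X := by
    calc X * Aim w = Aim w * Am w * X * Aim w := by rw [hA2, one_mul]
      _ = Aim w * (X * Am w) * Aim w := by rw [hA]; simp only [mul_assoc]
      _ = Aim w * X * (Am w * Aim w) := by simp only [mul_assoc]
      _ = Aim w * X := by rw [hA1, mul_one]
  have hlin : ∀ a b c : ℂ, X * (a • Am w + b • Aim w + c • 1) =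
      (a • Am w + b • Aim w + c • 1) * X := by
    intro a b c
    simp [mul_add, add_mul, hA, hAi]
  have h1 : Vim w * Vm w = 1 := Vi_V w hw
  have h2 : Vm w * Vim w = 1 := mul_eq_one_comm.1 h1
  have hUV := V_U w
  have hUV' : Um * Vim w = Vim w * Um := by
    calc Um * Vim w = (Vim w * Vm w) * Um * Vim w := by rw [h1, one_mul]
      _ = Vim w * (Vm w * Um) * Vim w := by simp only [mul_assoc]
      _ = Vim w * Um * (Vm w * Vim w) := by rw [hUV]; simp only [mul_assoc]
      _ = Vim w * Um := by rw [h2, mul_one]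
  have hmid : Vm w * Um * Vim w = Um := by rw [hUV, mul_assoc, h2, mul_one]
  obtain ⟨c, hc⟩ := key (Vim w * X * Vm w)
    (conj_comm w hw X _ _ (hlin _ _ _) (V_G w hw)) (conj_comm w hw X _ _ (hlin _ _ _) (V_H w hw)) (by
      calc Vim w * X * Vm w * Um * (Vim w * X * Vm w) * Um
          = Vim w * X * (Vm w * Um * Vim w) * X * (Vm w * Um) := by simp only [mul_assoc]
        _ = Vim w * (X * Um * X * Um) * Vm w := by rw [hmid, hUV]; simp only [mul_assoc]
        _ = (Vim w * Um) * X * (Vm w * Um * Vim w) * X * Vm w := by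
            rw [hU, hmid]; simp only [mul_assoc]
        _ = Um * (Vim w * X * Vm w) * Um * (Vim w * X * Vm w) := by
            rw [← hUV']; simp only [mul_assoc])
  refine ⟨c, ?_⟩
  calc X = (Vm w * Vim w) * X * (Vm w * Vim w) := by rw [h2, one_mul, mul_one]
    _ = Vm w * (Vim w * X * Vm w) * Vim w := by simp only [mul_assoc]
    _ = c • 1 := by rw [hc]; simp [h2]

lemma no_ext (w : ℂ) (hw : w ^ 2 = -1 - w) (S T : Matrix (Fin 6) (Fin 6) ℂ)
    (hS : S * S = 1) (hT : T * T = 1) (hST : S * T * S = T * S * T)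
    (h1 : S * T * Am w = Bm w * (S * T)) (h2 : Dm w * S = T * Dm w) : False := by
  have hA1 := A_Ai w hw
  obtain ⟨hD3, hT3, hTD, hCA, hCU⟩ := group_aux (Am w) (Bm w) (Dm w) Um (Aim w) S T
    (AB_eq w hw) (DA_eq w hw) (BD_eq w hw) U_U hA1 (mul_eq_one_comm.1 hA1) hS hT hST h1 h2
  obtain ⟨c, hc⟩ := scalar_of_comm w hw _ hCA hCU
  have hP : S * T = c • Dm w := by
    calc S * T = (Dm w * Dm w * Dm w) * (S * T) := by rw [hD3, one_mul]
      _ = Dm w * (Dm w * Dm w * (S * T)) := by simp only [mul_assoc]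
      _ = c • Dm w := by rw [hc]; simp
  rw [hP] at hT3 hTD
  have hc3 : c ^ 3 = 1 := by
    have h : (c ^ 3) • (1 : Matrix (Fin 6) (Fin 6) ℂ) = 1 := by
      simp only [smul_mul_assoc, mul_smul_comm, smul_smul] at hT3
      rw [hD3] at hT3
      rw [show c ^ 3 = c * c * c by ring]
      simpa [mul_assoc] using hT3
    have := congrFun (congrFun h 0) 0
    simpa using this
  have htr : (c • Dm w * Dm w).trace = (Dm w).trace := by
    rw [hTD, Matrix.trace_mul_comm, ← mul_assoc, hS, one_mul]
  simp [Matrix.trace, Fin.sum_univ_six, Matrix.mul_apply, Dm] at htr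
  have h3 : c * (1 - w) = 2 + w := by grind
  have h4 : c ^ 3 * (1 - w) ^ 3 = (2 + w) ^ 3 := by rw [← h3]; ring
  rw [hc3] at h4
  have h5 : 1 + 2 * w = 0 := by grind
  grind

lemma irred (w : ℂ) (hw : w ^ 2 = -1 - w) (W : Submodule ℂ (Fin 6 → ℂ))
    (hA : ∀ v ∈ W, (Am w).mulVec v ∈ W) (hB : ∀ v ∈ W, (Bm w).mulVec v ∈ W) :
    W = ⊥ ∨ W = ⊤ := by
  have hD : ∀ v ∈ W, (Dm w).mulVec v ∈ W := by
    intro v hv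
    rw [← AB_eq w hw, ← Matrix.mulVec_mulVec]
    exact hA _ (hB _ hv)
  have hU : ∀ v ∈ W, Um.mulVec v ∈ W := by
    intro v hv
    rw [← DA_eq w hw, ← Matrix.mulVec_mulVec]
    exact hD _ (hA _ hv)
  have hU' : ∀ a b c d e f : ℂ, ![a, b, c, d, e, f] ∈ W → ![a, b, c, -d, -e, -f] ∈ W := by
    intro a b c d e f h
    convert hU _ h using 1
    ext i
    fin_cases i <;> simp [Um, Matrix.mulVec_diagonal]
  have htop : ∀ a b c d e f : ℂ, ![a, b, c, d, e, f] ∈ W → ![a, b, c, 0, 0, 0] ∈ W := by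
    intro a b c d e f h
    convert W.smul_mem (1 / 2 : ℂ) (W.add_mem h (hU' _ _ _ _ _ _ h)) using 1
    ext i
    fin_cases i <;> simp <;> ring
  have hbot : ∀ a b c d e f : ℂ, ![a, b, c, d, e, f] ∈ W → ![0, 0, 0, d, e, f] ∈ W := by
    intro a b c d e f h
    convert W.smul_mem (1 / 2 : ℂ) (W.sub_mem h (hU' _ _ _ _ _ _ h)) using 1
    ext i
    fin_cases i <;> simp <;> ring
  have hA' : ∀ a b c d e f : ℂ, ![a, b, c, d, e, f] ∈ W →
      ![a + (1 - w) * b + (2 + w) * c + (w - 1) * d + (-2 - w) * e + (w - 1) * f,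
        (-2 - w) * a + (-1 - w) * b + (2 + w) * d,
        (-2 - w) * a + (-2 - w) * b + (-1 - w) * c + (2 + w) * d + (2 + w) * e,
        (w - 1) * b + (-2 - w) * c - w * d + (2 + w) * e + (1 - w) * f,
        (2 + w) * a + (2 + w) * b + (-2 - w) * d - e,
        (2 + w) * a + (2 + w) * b + (2 + w) * c + (-2 - w) * d + (-2 - w) * e - f] ∈ W := by
    intro a b c d e f h
    convert hA _ h using 1
    ext i
    fin_cases i <;> simp [Matrix.mulVec, dotProduct, Fin.sum_univ_six, Am, hw] <;> ring
  have hD' : ∀ a b c d e f : ℂ, ![a, b, c, d, e, f] ∈ W →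
      ![a + (2 + w) * b + (1 - w) * c + (2 + w) * d + (1 - w) * e + (2 + w) * f,
        (w - 1) * a + w * b + (w - 1) * d,
        (w - 1) * a + (w - 1) * b + w * c + (w - 1) * d + (w - 1) * e,
        (-2 - w) * b + (w - 1) * c + (-1 - w) * d + (w - 1) * e + (-2 - w) * f,
        (1 - w) * a + (1 - w) * b + (1 - w) * d + e,
        (1 - w) * a + (1 - w) * b + (1 - w) * c + (1 - w) * d + (1 - w) * e + f] ∈ W := by
    intro a b c d e f h
    convert hD _ h using 1
    ext i
    fin_cases i <;> simp [Matrix.mulVec, dotProduct, Fin.sum_univ_six, Dm] <;> ring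
  have hE : ∀ a b c d e f : ℂ, ![a, b, c, d, e, f] ∈ W →
      ![-(b + d + f), 0, 0, b + d + f, 0, 0] ∈ W := by
    intro a b c d e f h
    convert W.smul_mem (1 / 3 : ℂ) (W.add_mem h (W.add_mem (W.smul_mem w (hD' _ _ _ _ _ _ h))
      (W.smul_mem (w ^ 2) (hD' _ _ _ _ _ _ (hD' _ _ _ _ _ _ h))))) using 1
    ext i
    fin_cases i <;> simp <;> grind
  by_cases h0 : ![-1, 0, 0, 1, 0, 0] ∈ W
  · right
    have e0 : ![1, 0, 0, 0, 0, 0] ∈ W := by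
      convert W.smul_mem (-1 : ℂ) (htop _ _ _ _ _ _ h0) using 1
      ext i
      fin_cases i <;> simp
    have e3 := hbot _ _ _ _ _ _ h0
    have a0 := hA' _ _ _ _ _ _ e0
    have m1 := htop _ _ _ _ _ _ a0
    have n1 := hbot _ _ _ _ _ _ a0
    have x : ![0, 1, 1, 0, 0, 0] ∈ W := by
      convert W.smul_mem ((1 - w) / 3) (W.sub_mem e0 m1) using 1
      ext i
      fin_cases i <;> simp <;> grind
    have a1 := hA' _ _ _ _ _ _ x
    have m2 := htop _ _ _ _ _ _ a1
    have n2 := hbot _ _ _ _ _ _ a1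
    have e2 : ![0, 0, 1, 0, 0, 0] ∈ W := by
      convert W.smul_mem (-(1 - w) / 3) (W.sub_mem m2 (W.add_mem (W.smul_mem (3 : ℂ) e0)
        (W.smul_mem (-1 - w) x))) using 1
      ext i
      fin_cases i <;> simp <;> grind
    have e1 : ![0, 1, 0, 0, 0, 0] ∈ W := by
      convert W.sub_mem x e2 using 1
      ext i
      fin_cases i <;> simp
    have e5 : ![0, 0, 0, 0, 0, 1] ∈ W := by
      convert W.smul_mem ((1 - w) / 3) (W.sub_mem (W.add_mem n2 (W.smul_mem (3 : ℂ) e3)) n1) using 1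
      ext i
      fin_cases i <;> simp <;> grind
    have e4 : ![0, 0, 0, 0, 1, 0] ∈ W := by
      convert W.sub_mem (W.smul_mem ((1 - w) / 3) n1) e5 using 1
      ext i
      fin_cases i <;> simp <;> grind
    rw [eq_top_iff]
    intro v _
    convert W.add_mem (W.smul_mem (v 0) e0) (W.add_mem (W.smul_mem (v 1) e1)
      (W.add_mem (W.smul_mem (v 2) e2) (W.add_mem (W.smul_mem (v 3) e3)
      (W.add_mem (W.smul_mem (v 4) e4) (W.smul_mem (v 5) e5))))) using 1
    ext i
    fin_cases i <;> simp
  · left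
    have hz : ∀ a b c d e f : ℂ, ![a, b, c, d, e, f] ∈ W → b + d + f = 0 := by
      intro a b c d e f h
      by_contra hne
      apply h0
      convert W.smul_mem (b + d + f)⁻¹ (hE _ _ _ _ _ _ h) using 1
      ext i
      fin_cases i <;> simp <;> field_simp <;> ring
    have hz1 : ∀ a b c d e f : ℂ, ![a, b, c, d, e, f] ∈ W → b = 0 := by
      intro a b c d e f h
      have := hz _ _ _ _ _ _ (htop _ _ _ _ _ _ h)
      simpa using this
    have hw3 : (1 - w) * (2 + w) = 3 := by grind
    have hw2 : (2 + w) ≠ 0 := by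
      intro h
      rw [h] at hw3
      norm_num at hw3
    rw [eq_bot_iff]
    have hfin : ∀ a b c d e f : ℂ, ![a, b, c, d, e, f] ∈ W →
        a = 0 ∧ b = 0 ∧ c = 0 ∧ d = 0 ∧ e = 0 ∧ f = 0 := by
      have stepb : ∀ a b c d e f : ℂ, ![a, b, c, d, e, f] ∈ W → a = 0 ∧ d = 0 := by
        intro a b c d e f h
        have hb := hz1 _ _ _ _ _ _ h
        have ht := hz1 _ _ _ _ _ _ (hA' _ _ _ _ _ _ (htop _ _ _ _ _ _ h))
        have hu := hz1 _ _ _ _ _ _ (hA' _ _ _ _ _ _ (hbot _ _ _ _ _ _ h))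
        subst hb
        constructor
        · apply (mul_eq_zero.1 (show (2 + w) * a = 0 by linear_combination -ht)).resolve_left hw2
        · apply (mul_eq_zero.1 (show (2 + w) * d = 0 by linear_combination hu)).resolve_left hw2
      intro a b c d e f h
      have hb := hz1 _ _ _ _ _ _ h
      obtain ⟨ha, hd⟩ := stepb _ _ _ _ _ _ h
      have hf := hz _ _ _ _ _ _ h
      have ht := (stepb _ _ _ _ _ _ (hA' _ _ _ _ _ _ (htop _ _ _ _ _ _ h))).1
      have hu := (stepb _ _ _ _ _ _ (hA' _ _ _ _ _ _ (hbot _ _ _ _ _ _ h))).1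
      subst ha hb hd
      have hf' : f = 0 := by linear_combination hf
      subst hf'
      refine ⟨rfl, rfl, ?_, rfl, ?_, rfl⟩
      · apply (mul_eq_zero.1 (show (2 + w) * c = 0 by linear_combination ht)).resolve_left hw2
      · apply (mul_eq_zero.1 (show (2 + w) * e = 0 by linear_combination -hu)).resolve_left hw2
    intro v hv
    have hv' : v = ![v 0, v 1, v 2, v 3, v 4, v 5] := by
      ext i
      fin_cases i <;> simp
    rw [hv'] at hv
    obtain ⟨k0, k1, k2, k3, k4, k5⟩ := hfin _ _ _ _ _ _ hv
    rw [Submodule.mem_bot]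
    ext i
    fin_cases i <;> simp [k0, k1, k2, k3, k4, k5]

/-- Proposition 6.1: with `ω = e^{2πi/3}`, the explicit `6 × 6` matrices `A, B`
below define an irreducible representation of `B₃` which admits no extension
to `LB₃`. -/
theorem stmt_19 (ω : ℂ) (hω : ω = Complex.exp (2 * Real.pi * Complex.I / 3))
    (A B : Matrix (Fin 6) (Fin 6) ℂ)
    (hAdef : A = !![1, 1 - ω, 1 - ω^2, ω - 1, ω^2 - 1, ω - 1;
                    ω^2 - 1, ω^2, 0, 1 - ω^2, 0, 0;
                    ω^2 - 1, ω^2 - 1, ω^2, 1 - ω^2, 1 - ω^2, 0;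
                    0, ω - 1, ω^2 - 1, -ω, 1 - ω^2, 1 - ω;
                    1 - ω^2, 1 - ω^2, 0, ω^2 - 1, -1, 0;
                    1 - ω^2, 1 - ω^2, 1 - ω^2, ω^2 - 1, ω^2 - 1, -1])
    (hBdef : B = !![1, 1 - ω, 1 - ω^2, 1 - ω, 1 - ω^2, 1 - ω;
                    ω^2 - 1, ω^2, 0, ω^2 - 1, 0, 0;
                    ω^2 - 1, ω^2 - 1, ω^2, ω^2 - 1, ω^2 - 1, 0;
                    0, 1 - ω, 1 - ω^2, -ω, 1 - ω^2, 1 - ω;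
                    ω^2 - 1, ω^2 - 1, 0, ω^2 - 1, -1, 0;
                    ω^2 - 1, ω^2 - 1, ω^2 - 1, ω^2 - 1, ω^2 - 1, -1]) :
    IsUnit A ∧ IsUnit B ∧
    A * B * A = B * A * B ∧
    (∀ W : Submodule ℂ (Fin 6 → ℂ),
      (∀ v ∈ W, A.mulVec v ∈ W) → (∀ v ∈ W, B.mulVec v ∈ W) →
      W = ⊥ ∨ W = ⊤) ∧
    ¬∃ S₁ S₂ : Matrix (Fin 6) (Fin 6) ℂ,
      S₁ ^ 2 = 1 ∧ S₂ ^ 2 = 1 ∧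
      S₁ * S₂ * S₁ = S₂ * S₁ * S₂ ∧
      S₁ * S₂ * A = B * (S₁ * S₂) ∧
      A * B * S₁ = S₂ * (A * B) := by
  have hw : ω ^ 2 = -1 - ω := by
    have hprim : IsPrimitiveRoot ω 3 := by
      rw [hω]
      exact_mod_cast Complex.isPrimitiveRoot_exp 3 (by norm_num)
    have h3 := hprim.pow_eq_one
    have hne : ω - 1 ≠ 0 := sub_ne_zero.2 (hprim.ne_one (by norm_num))
    have : (ω - 1) * (ω ^ 2 + ω + 1) = 0 := by linear_combination h3
    have := (mul_eq_zero.1 this).resolve_left hne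
    linear_combination this
  have hA : A = Am ω := hAdef
  have hB : B = Bm ω := hBdef
  clear hAdef hBdef hω
  subst hA hB
  have hAB := AB_eq ω hw
  have hDA := DA_eq ω hw
  have hBD := BD_eq ω hw
  refine ⟨?_, ?_, ?_, irred ω hw, ?_⟩
  · exact IsUnit.of_mul_eq_one _ (A_Ai ω hw)
  · refine IsUnit.of_mul_eq_one (Dm ω * Um) ?_
    rw [← mul_assoc, hBD, U_U]
  · rw [hAB, hDA, mul_assoc, hAB, hBD]
  · rintro ⟨S, T, hS, hT, hST, h1, h2⟩
    rw [hAB] at h2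
    rw [pow_two] at hS hT
    exact no_ext ω hw S T hS hT hST h1 h2
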